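/- If Θ < 1, Ω < 1 and Γ > 1, then f₁ ∈ Lip δ with δ = min( λ, log γ / log |I_min| ), i.e. there exists C > 0 such that |f₁(x) − f₁(y)| ≤ C|x − y|^δ for all x, y ∈ [0,1]. -/

import Mathlib

/-- Minimum of `g i` over `i = 1, …, N`. -/
noncomputable def minOver (N : ℕ) (g : ℕ → ℝ) : ℝ := sInf (g '' Set.Icc 1 N)

/-- Maximum of `g i` over `i = 1, …, N`. -/
noncomputable def maxOver (N : ℕ) (g : ℕ → ℝ) : ℝ := sSup (g '' Set.Icc 1 N)

theorem minOver_le {N : ℕ} (g : ℕ → ℝ) {i : ℕ} (hi : i ∈ Set.Icc 1 N) : minOver N g ≤ g i :=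
  csInf_le ((Set.finite_Icc 1 N).image g).bddBelow (Set.mem_image_of_mem g hi)

theorem le_maxOver {N : ℕ} (g : ℕ → ℝ) {i : ℕ} (hi : i ∈ Set.Icc 1 N) : g i ≤ maxOver N g :=
  le_csSup ((Set.finite_Icc 1 N).image g).bddAbove (Set.mem_image_of_mem g hi)

theorem exists_eq_minOver {N : ℕ} (hN : 1 ≤ N) (g : ℕ → ℝ) :
    ∃ i ∈ Set.Icc 1 N, g i = minOver N g :=
  Set.Nonempty.csInf_mem ((Set.nonempty_Icc.2 hN).image g) ((Set.finite_Icc 1 N).image g)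

theorem exists_eq_maxOver {N : ℕ} (hN : 1 ≤ N) (g : ℕ → ℝ) :
    ∃ i ∈ Set.Icc 1 N, g i = maxOver N g :=
  Set.Nonempty.csSup_mem ((Set.nonempty_Icc.2 hN).image g) ((Set.finite_Icc 1 N).image g)

/-- A modulus bound for `f` holds on a family of pairs if every pair either satisfies it or
inherits it from a pair of the family that is farther apart by a definite factor. -/
theorem modulus_of_rescaling {P : ℝ → ℝ → Prop} {f ω : ℝ → ℝ} {r : ℝ} (hr : r < 1)
    (hP : ∀ s t, P s t → |s - t| ≤ 1)
    (hf : ∀ s t, P s t → 0 < |s - t| → |f s - f t| ≤ ω |s - t| ∨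
      ∃ s' t' c, P s' t' ∧ 0 < c ∧ c ≤ r ∧ |s - t| = c * |s' - t'| ∧
        (|f s' - f t'| ≤ ω |s' - t'| → |f s - f t| ≤ ω |s - t|))
    {s t : ℝ} (hst : P s t) (h0 : 0 < |s - t|) : |f s - f t| ≤ ω |s - t| := by
  have key : ∀ n : ℕ, ∀ s t, P s t → r ^ n < |s - t| → 0 < |s - t| →
      |f s - f t| ≤ ω |s - t| := by
    intro n
    induction n with
    | zero =>
      intro s t hst h
      have := hP s t hst
      rw [pow_zero] at h
      linarith
    | succ n ih =>
      intro s t hst h h0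
      rcases hf s t hst h0 with h1 | ⟨s', t', c, hst', hc, hcr, he, himp⟩
      · exact h1
      · have h0' : 0 < |s' - t'| := by
          rw [he] at h0
          exact (mul_pos_iff_of_pos_left hc).1 h0
        refine himp (ih s' t' hst' ?_ h0')
        have hle : c * |s' - t'| ≤ r * |s' - t'| := by gcongr
        rw [pow_succ', he] at h
        exact lt_of_mul_lt_mul_left (h.trans_le hle) (hc.le.trans hcr)
  rcases le_or_gt r 0 with hr0 | hr0
  · rcases hf s t hst h0 with h1 | ⟨_, _, c, _, hc, hcr, _, _⟩
    · exact h1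
    · linarith
  · obtain ⟨n, hn⟩ := exists_pow_lt_of_lt_one h0 hr
    exact key n s t hst hn h0

theorem partition_mono {N : ℕ} {x : ℕ → ℝ} (hx : ∀ i < N, x i < x (i + 1)) {i j : ℕ}
    (hij : i ≤ j) (hj : j ≤ N) : x i ≤ x j := by
  induction j, hij using Nat.le_induction with
  | base => exact le_rfl
  | succ j _ ih => exact (ih (by omega)).trans (hx j (by omega)).le

theorem partition_length_pos {N : ℕ} {x : ℕ → ℝ} (hx : ∀ i < N, x i < x (i + 1)) {i : ℕ}
    (hi : i ∈ Set.Icc 1 N) : 0 < x i - x (i - 1) := by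
  have h := hx (i - 1) (by have := hi.1; have := hi.2; omega)
  rw [Nat.sub_add_cancel hi.1] at h
  linarith

theorem partition_length_lt_one {N : ℕ} (hN : 2 ≤ N) {x : ℕ → ℝ} (hx0 : x 0 = 0) (hxN : x N = 1)
    (hx : ∀ i < N, x i < x (i + 1)) {i : ℕ} (hi : i ∈ Set.Icc 1 N) : x i - x (i - 1) < 1 := by
  obtain ⟨h1, h2⟩ := hi
  rcases h1.eq_or_lt with rfl | h1
  · have h3 := hx 1 (by omega)
    have h4 := partition_mono hx (show 1 + 1 ≤ N by omega) le_rfl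
    simp only [le_refl, tsub_eq_zero_of_le, hx0]
    linarith
  · have h3 := hx 0 (by omega)
    have h4 := partition_mono hx (show 0 + 1 ≤ i - 1 by omega) (by omega)
    have h5 := partition_mono hx h2 le_rfl
    linarith

theorem exists_mem_partition_interval {N : ℕ} (hN : 1 ≤ N) {x : ℕ → ℝ} (hx0 : x 0 = 0)
    (hxN : x N = 1) {s : ℝ} (hs : s ∈ Set.Icc (0 : ℝ) 1) :
    ∃ i ∈ Set.Icc 1 N, x (i - 1) ≤ s ∧ s ≤ x i := by
  classical
  have hex : ∃ j, 1 ≤ j ∧ s ≤ x j := ⟨N, hN, by rw [hxN]; exact hs.2⟩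
  obtain ⟨h1, h2⟩ := Nat.find_spec hex
  refine ⟨Nat.find hex, ⟨h1, Nat.find_min' hex ⟨hN, by rw [hxN]; exact hs.2⟩⟩, ?_, h2⟩
  rcases h1.eq_or_lt with h | h
  · rw [← h]
    simpa [hx0] using hs.1
  · have := Nat.find_min hex (m := Nat.find hex - 1) (by omega)
    by_contra! hlt
    exact this ⟨by omega, hlt.le⟩

theorem exists_affine_preimage {a b s : ℝ} (hab : 0 < b - a) (h1 : a ≤ s) (h2 : s ≤ b) :
    ∃ s' ∈ Set.Icc (0 : ℝ) 1, (b - a) * s' + a = s := by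
  refine ⟨(s - a) / (b - a), ⟨by apply div_nonneg <;> linarith, ?_⟩, ?_⟩
  · rw [div_le_one hab]; linarith
  · field_simp; ring

/-- Hölder regularity of a self-affine function, given a family of moduli comparable to `h ^ τ`
that are preserved by the functional equation. -/
theorem holder_of_selfAffine {N : ℕ} (hN : 2 ≤ N) {x : ℕ → ℝ} (hx0 : x 0 = 0) (hxN : x N = 1)
    (hx : ∀ i < N, x i < x (i + 1)) {a : ℕ → ℝ} {g : ℕ → ℝ → ℝ} {f : ℝ → ℝ} {M τ η : ℝ}
    (hτ : 0 < τ) (hfc : ContinuousOn f (Set.Icc 0 1))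
    (hg : ∀ i ∈ Set.Icc 1 N, ∀ s ∈ Set.Icc (0 : ℝ) 1, ∀ t ∈ Set.Icc (0 : ℝ) 1,
      |g i s - g i t| ≤ M * |s - t| ^ η)
    (heq : ∀ i ∈ Set.Icc 1 N, ∀ t ∈ Set.Icc (0 : ℝ) 1,
      f ((x i - x (i - 1)) * t + x (i - 1)) = a i * f t + g i t)
    (hω : ∀ K : ℝ, 0 < K → ∃ ω : ℝ → ℝ, ∃ C : ℝ, 0 < C ∧
      (∀ h, 0 < h → h ≤ 1 → K * h ^ τ ≤ ω h ∧ ω h ≤ C * h ^ τ) ∧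
      ∀ i ∈ Set.Icc 1 N, ∀ h, 0 < h → h ≤ 1 →
        |a i| * ω h + M * h ^ η ≤ ω ((x i - x (i - 1)) * h)) :
    ∃ C > 0, ∀ s ∈ Set.Icc (0 : ℝ) 1, ∀ t ∈ Set.Icc (0 : ℝ) 1,
      |f s - f t| ≤ C * |s - t| ^ τ := by
  have hN1 : 1 ≤ N := by omega
  have hlpos : ∀ i ∈ Set.Icc 1 N, 0 < x i - x (i - 1) := fun i hi => partition_length_pos hx hi
  obtain ⟨ic, hic, hc⟩ := exists_eq_minOver hN1 (fun i => x i - x (i - 1))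
  obtain ⟨ir, hir, hr⟩ := exists_eq_maxOver hN1 (fun i => x i - x (i - 1))
  have hcle := fun i (hi : i ∈ Set.Icc 1 N) => minOver_le (fun i => x i - x (i - 1)) hi
  have hler := fun i (hi : i ∈ Set.Icc 1 N) => le_maxOver (fun i => x i - x (i - 1)) hi
  have hc0 := hlpos ic hic
  have hr1 := partition_length_lt_one hN hx0 hxN hx hir
  rw [hc] at hc0
  rw [hr] at hr1
  set c := minOver N (fun i => x i - x (i - 1))
  set r := maxOver N (fun i => x i - x (i - 1))
  obtain ⟨F, hF⟩ := isCompact_Icc.exists_bound_of_continuousOn hfc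
  have hdist : ∀ s ∈ Set.Icc (0 : ℝ) 1, ∀ t ∈ Set.Icc (0 : ℝ) 1, |s - t| ≤ 1 := by
    rintro s ⟨hs0, hs1⟩ t ⟨ht0, ht1⟩
    rw [abs_le]; constructor <;> linarith
  have hF0 : 0 ≤ F := (norm_nonneg _).trans (hF 0 (by simp))
  set K := (2 * F + 1) / c ^ τ with hK
  have hcτ : 0 < c ^ τ := Real.rpow_pos_of_pos hc0 τ
  have hK0 : 0 < K := by positivity
  have hfar : ∀ s ∈ Set.Icc (0 : ℝ) 1, ∀ t ∈ Set.Icc (0 : ℝ) 1, c ≤ |s - t| →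
      |f s - f t| ≤ K * |s - t| ^ τ := by
    intro s hs t ht h
    have h1 : |f s - f t| ≤ 2 * F + 1 := by
      have h1 := abs_le.1 (hF s hs)
      have h2 := abs_le.1 (hF t ht)
      rw [abs_le]; constructor <;> linarith
    calc |f s - f t| ≤ K * c ^ τ := by rw [hK, div_mul_cancel₀ _ hcτ.ne']; exact h1
      _ ≤ K * |s - t| ^ τ := by gcongr
  have hstep : ∀ ω : ℝ → ℝ, (∀ i ∈ Set.Icc 1 N, ∀ h, 0 < h → h ≤ 1 →
        |a i| * ω h + M * h ^ η ≤ ω ((x i - x (i - 1)) * h)) →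
      ∀ i ∈ Set.Icc 1 N, ∀ s ∈ Set.Icc (0 : ℝ) 1, ∀ t ∈ Set.Icc (0 : ℝ) 1, 0 < |s - t| →
      |f s - f t| ≤ ω |s - t| →
      |f ((x i - x (i - 1)) * s + x (i - 1)) - f ((x i - x (i - 1)) * t + x (i - 1))|
        ≤ ω ((x i - x (i - 1)) * |s - t|) := by
    intro ω hω i hi s hs t ht h0 h
    refine le_trans ?_ (hω i hi _ h0 (hdist s hs t ht))
    rw [heq i hi s hs, heq i hi t ht]
    calc |a i * f s + g i s - (a i * f t + g i t)| = |a i * (f s - f t) + (g i s - g i t)| := by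
          congr 1; ring
      _ ≤ |a i| * |f s - f t| + |g i s - g i t| := by
          rw [← abs_mul]; exact abs_add_le _ _
      _ ≤ _ := by gcongr; exact hg i hi s hs t ht
  have hscale : ∀ i ∈ Set.Icc 1 N, ∀ s t : ℝ,
      |((x i - x (i - 1)) * s + x (i - 1)) - ((x i - x (i - 1)) * t + x (i - 1))|
        = (x i - x (i - 1)) * |s - t| := by
    intro i hi s t
    rw [← abs_of_pos (hlpos i hi), ← abs_mul, abs_of_pos (hlpos i hi)]
    congr 1; ring
  have hstep' : ∀ ω : ℝ → ℝ, (∀ i ∈ Set.Icc 1 N, ∀ h, 0 < h → h ≤ 1 →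
        |a i| * ω h + M * h ^ η ≤ ω ((x i - x (i - 1)) * h)) →
      ∀ i ∈ Set.Icc 1 N, ∀ s ∈ Set.Icc (0 : ℝ) 1, ∀ t ∈ Set.Icc (0 : ℝ) 1, ∀ u v : ℝ,
      (x i - x (i - 1)) * s + x (i - 1) = u → (x i - x (i - 1)) * t + x (i - 1) = v →
      0 < |u - v| →
      0 < |s - t| ∧ |u - v| = (x i - x (i - 1)) * |s - t| ∧
      (|f s - f t| ≤ ω |s - t| → |f u - f v| ≤ ω |u - v|) := by
    rintro ω hω i hi s hs t ht u v rfl rfl h0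
    rw [hscale i hi] at h0 ⊢
    have h0' : 0 < |s - t| := (mul_pos_iff_of_pos_left (hlpos i hi)).1 h0
    exact ⟨h0', rfl, hstep ω hω i hi s hs t ht h0'⟩
  have hx1 : ∀ i : ℕ, (x i - x (i - 1)) * 1 + x (i - 1) = x i := fun i => by ring
  have hxz : ∀ i : ℕ, (x i - x (i - 1)) * 0 + x (i - 1) = x (i - 1) := fun i => by ring
  have m0 : (0 : ℝ) ∈ Set.Icc (0 : ℝ) 1 := by simp
  have m1 : (1 : ℝ) ∈ Set.Icc (0 : ℝ) 1 := by simp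
  have mi : ∀ i ≤ N, x i ∈ Set.Icc (0 : ℝ) 1 := fun i hi =>
    ⟨hx0 ▸ partition_mono hx (Nat.zero_le i) hi, hxN ▸ partition_mono hx hi le_rfl⟩
  obtain ⟨ω, C, hC, hωb, hωs⟩ := hω K hK0
  have hleft : ∀ s t : ℝ, (s = 0 ∧ t ∈ Set.Icc (0 : ℝ) 1) → 0 < |s - t| →
      |f s - f t| ≤ ω |s - t| := by
    intro s t hst h0
    refine modulus_of_rescaling (P := fun s t => s = 0 ∧ t ∈ Set.Icc (0 : ℝ) 1) hr1 ?_ ?_ hst h0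
    · rintro s t ⟨rfl, ht⟩; exact hdist _ m0 _ ht
    · rintro s t ⟨rfl, ht⟩ h0
      have h1N : 1 ∈ Set.Icc 1 N := ⟨le_rfl, hN1⟩
      rcases le_or_gt t (x 1) with h | h
      · right
        obtain ⟨t', ht', he⟩ := exists_affine_preimage (hlpos 1 h1N) (by simpa [hx0] using ht.1) h
        obtain ⟨-, h2, h3⟩ := hstep' ω hωs 1 h1N 0 m0 t' ht' 0 t (by simp [hx0]) he h0
        exact ⟨0, t', _, ⟨rfl, ht'⟩, hlpos 1 h1N, hler 1 h1N, h2, h3⟩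
      · left
        refine (hfar 0 m0 t ht ?_).trans (hωb _ h0 (hdist 0 m0 t ht)).1
        have := hcle 1 h1N
        simp only [le_refl, tsub_eq_zero_of_le, hx0, sub_zero] at this
        rw [zero_sub, abs_neg, abs_of_nonneg ht.1]
        linarith
  have hright : ∀ s t : ℝ, (t = 1 ∧ s ∈ Set.Icc (0 : ℝ) 1) → 0 < |s - t| →
      |f s - f t| ≤ ω |s - t| := by
    intro s t hst h0
    refine modulus_of_rescaling (P := fun s t => t = 1 ∧ s ∈ Set.Icc (0 : ℝ) 1) hr1 ?_ ?_ hst h0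
    · rintro s t ⟨rfl, hs⟩; exact hdist _ hs _ m1
    · rintro s t ⟨rfl, hs⟩ h0
      have hNN : N ∈ Set.Icc 1 N := ⟨hN1, le_rfl⟩
      rcases le_or_gt (x (N - 1)) s with h | h
      · right
        obtain ⟨s', hs', he⟩ := exists_affine_preimage (hlpos N hNN) h (by rw [hxN]; exact hs.2)
        obtain ⟨-, h2, h3⟩ := hstep' ω hωs N hNN s' hs' 1 m1 s 1 he (by rw [hx1, hxN]) h0
        exact ⟨s', 1, _, ⟨rfl, hs'⟩, hlpos N hNN, hler N hNN, h2, h3⟩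
      · left
        refine (hfar s hs 1 m1 ?_).trans (hωb _ h0 (hdist s hs 1 m1)).1
        have := hcle N hNN
        rw [abs_sub_comm, abs_of_nonneg (by linarith [hs.2])]
        rw [hxN] at this
        linarith
  obtain ⟨ψ, D, hD, hψb, hψs⟩ := hω (K + 2 * C) (by positivity)
  have hall : ∀ s t : ℝ, (s ∈ Set.Icc (0 : ℝ) 1 ∧ t ∈ Set.Icc (0 : ℝ) 1 ∧ s ≤ t) →
      0 < |s - t| → |f s - f t| ≤ ψ |s - t| := by
    intro s t hst h0
    refine modulus_of_rescaling
      (P := fun s t => s ∈ Set.Icc (0 : ℝ) 1 ∧ t ∈ Set.Icc (0 : ℝ) 1 ∧ s ≤ t) hr1 ?_ ?_ hst h0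
    · rintro s t ⟨hs, ht, -⟩; exact hdist _ hs _ ht
    · rintro s t ⟨hs, ht, hst⟩ h0
      obtain ⟨i, hi, hi1, hi2⟩ := exists_mem_partition_interval hN1 hx0 hxN hs
      have hpow : 0 ≤ |s - t| ^ τ := by positivity
      rcases le_or_gt t (x i) with h | h
      · right
        obtain ⟨s', hs', hes⟩ := exists_affine_preimage (hlpos i hi) hi1 hi2
        obtain ⟨t', ht', het⟩ := exists_affine_preimage (hlpos i hi) (hi1.trans hst) h
        obtain ⟨-, h2, h3⟩ := hstep' ψ hψs i hi s' hs' t' ht' s t hes het h0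
        refine ⟨s', t', _, ⟨hs', ht', ?_⟩, hlpos i hi, hler i hi, h2, h3⟩
        refine le_of_mul_le_mul_left ?_ (hlpos i hi)
        linarith
      · left
        refine le_trans ?_ (hψb _ h0 (hdist s hs t ht)).1
        have hiN : i < N := by
          refine lt_of_le_of_ne hi.2 ?_
          rintro rfl
          linarith [ht.2]
        have hi' : i + 1 ∈ Set.Icc 1 N := ⟨by omega, by omega⟩
        rcases le_or_gt t (x (i + 1)) with h' | h'
        · have mxi := mi i hi.2
          have hb1 : |f s - f (x i)| ≤ C * |s - t| ^ τ := by
            rcases hi2.eq_or_lt with he | hlt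
            · rw [he, sub_self, abs_zero]; positivity
            obtain ⟨s', hs', hes⟩ := exists_affine_preimage (hlpos i hi) hi1 hi2
            have hpos : 0 < |s - x i| := abs_pos.2 (by linarith)
            obtain ⟨h1, h2, h3⟩ := hstep' ω hωs i hi s' hs' 1 m1 s (x i) hes (hx1 i) hpos
            refine (h3 (hright s' 1 ⟨rfl, hs'⟩ h1)).trans
              ((hωb _ hpos (hdist _ hs _ mxi)).2.trans ?_)
            gcongr 1
            refine Real.rpow_le_rpow (abs_nonneg _) ?_ hτ.le
            rw [abs_sub_comm, abs_of_nonneg (by linarith), abs_sub_comm, abs_of_nonneg (by linarith)]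
            linarith
          have hb2 : |f (x i) - f t| ≤ C * |s - t| ^ τ := by
            obtain ⟨t', ht', het⟩ := exists_affine_preimage (hlpos (i + 1) hi')
              (by simpa using h.le) h'
            have hpos : 0 < |x i - t| := abs_pos.2 (by linarith)
            obtain ⟨h1, h2, h3⟩ := hstep' ω hωs (i + 1) hi' 0 m0 t' ht' (x i) t
              (by simp) het hpos
            refine (h3 (hleft 0 t' ⟨rfl, ht'⟩ h1)).trans
              ((hωb _ hpos (hdist _ mxi _ ht)).2.trans ?_)
            gcongr 1
            refine Real.rpow_le_rpow (abs_nonneg _) ?_ hτ.le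
            rw [abs_sub_comm, abs_of_nonneg (by linarith), abs_sub_comm, abs_of_nonneg (by linarith)]
            linarith
          have := abs_sub_le (f s) (f (x i)) (f t)
          nlinarith [mul_nonneg hK0.le hpow]
        · have h1 := hcle (i + 1) hi'
          rw [Nat.add_sub_cancel] at h1
          have h2 := hfar s hs t ht (by
            rw [abs_sub_comm, abs_of_nonneg (by linarith)]; linarith)
          nlinarith [mul_nonneg hC.le hpow]
  have hall' : ∀ s ∈ Set.Icc (0 : ℝ) 1, ∀ t ∈ Set.Icc (0 : ℝ) 1, s ≤ t →
      |f s - f t| ≤ D * |s - t| ^ τ := by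
    intro s hs t ht hst
    rcases hst.eq_or_lt with rfl | hlt
    · rw [sub_self, abs_zero]; positivity
    · have hpos : 0 < |s - t| := abs_pos.2 (by linarith)
      exact (hall s t ⟨hs, ht, hst⟩ hpos).trans (hψb _ hpos (hdist s hs t ht)).2
  refine ⟨D, hD, fun s hs t ht => ?_⟩
  rcases le_total s t with h | h
  · exact hall' s hs t ht h
  · rw [abs_sub_comm (f s), abs_sub_comm s]
    exact hall' t ht s hs h

/-- Critical case: the vertical scalings may equal `l ^ τ`, the inhomogeneity being smoother. -/
theorem holder_of_selfAffine_of_lt {N : ℕ} (hN : 2 ≤ N) {x : ℕ → ℝ} (hx0 : x 0 = 0)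
    (hxN : x N = 1) (hx : ∀ i < N, x i < x (i + 1)) {a : ℕ → ℝ} {g : ℕ → ℝ → ℝ} {f : ℝ → ℝ}
    {M τ η : ℝ} (hM : 0 ≤ M) (hτ : 0 < τ) (hτη : τ < η)
    (ha : ∀ i ∈ Set.Icc 1 N, |a i| ≤ (x i - x (i - 1)) ^ τ)
    (hfc : ContinuousOn f (Set.Icc 0 1))
    (hg : ∀ i ∈ Set.Icc 1 N, ∀ s ∈ Set.Icc (0 : ℝ) 1, ∀ t ∈ Set.Icc (0 : ℝ) 1,
      |g i s - g i t| ≤ M * |s - t| ^ η)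
    (heq : ∀ i ∈ Set.Icc 1 N, ∀ t ∈ Set.Icc (0 : ℝ) 1,
      f ((x i - x (i - 1)) * t + x (i - 1)) = a i * f t + g i t) :
    ∃ C > 0, ∀ s ∈ Set.Icc (0 : ℝ) 1, ∀ t ∈ Set.Icc (0 : ℝ) 1,
      |f s - f t| ≤ C * |s - t| ^ τ := by
  refine holder_of_selfAffine hN hx0 hxN hx hτ hfc hg heq fun K hK => ?_
  have hl : ∀ i ∈ Set.Icc 1 N, 0 < x i - x (i - 1) := fun i hi => partition_length_pos hx hi
  have hgap : ∀ i ∈ Set.Icc 1 N, 0 < (x i - x (i - 1)) ^ τ - (x i - x (i - 1)) ^ η :=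
    fun i hi => sub_pos.2 (Real.rpow_lt_rpow_of_exponent_gt (hl i hi)
      (partition_length_lt_one hN hx0 hxN hx hi) hτη)
  have hB := fun i (hi : i ∈ Set.Icc 1 N) =>
    le_maxOver (fun i => M / ((x i - x (i - 1)) ^ τ - (x i - x (i - 1)) ^ η)) hi
  set B := maxOver N (fun i => M / ((x i - x (i - 1)) ^ τ - (x i - x (i - 1)) ^ η))
  have hB0 : 0 ≤ B := (div_nonneg hM (hgap 1 ⟨le_rfl, by omega⟩).le).trans
    (hB 1 ⟨le_rfl, by omega⟩)
  have hpow : ∀ h : ℝ, 0 < h → h ≤ 1 → h ^ η ≤ h ^ τ := fun h h0 h1 =>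
    Real.rpow_le_rpow_of_exponent_ge h0 h1 hτη.le
  have hlow : ∀ h : ℝ, 0 < h → h ≤ 1 → K * h ^ τ ≤ (K + B) * h ^ τ - B * h ^ η := by
    intro h h0 h1
    nlinarith [mul_le_mul_of_nonneg_left (hpow h h0 h1) hB0]
  refine ⟨fun h => (K + B) * h ^ τ - B * h ^ η, K + B, by positivity, fun h h0 h1 =>
    ⟨hlow h h0 h1, sub_le_self _ (by positivity)⟩, fun i hi h h0 h1 => ?_⟩
  have hω0 : 0 ≤ (K + B) * h ^ τ - B * h ^ η := (by positivity : 0 ≤ K * h ^ τ).trans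
    (hlow h h0 h1)
  have h2 := mul_le_mul_of_nonneg_right (ha i hi) hω0
  have h3 := (div_le_iff₀ (hgap i hi)).1 (hB i hi)
  have h4 := mul_le_mul_of_nonneg_right h3 (Real.rpow_nonneg h0.le η)
  simp only [Real.mul_rpow (hl i hi).le h0.le]
  linarith

/-- Subcritical case: the vertical scalings are strictly below `l ^ τ`. -/
theorem holder_of_selfAffine_of_scaling_lt {N : ℕ} (hN : 2 ≤ N) {x : ℕ → ℝ} (hx0 : x 0 = 0)
    (hxN : x N = 1) (hx : ∀ i < N, x i < x (i + 1)) {a : ℕ → ℝ} {g : ℕ → ℝ → ℝ} {f : ℝ → ℝ}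
    {M τ : ℝ} (hτ : 0 < τ)
    (ha : ∀ i ∈ Set.Icc 1 N, |a i| < (x i - x (i - 1)) ^ τ)
    (hfc : ContinuousOn f (Set.Icc 0 1))
    (hg : ∀ i ∈ Set.Icc 1 N, ∀ s ∈ Set.Icc (0 : ℝ) 1, ∀ t ∈ Set.Icc (0 : ℝ) 1,
      |g i s - g i t| ≤ M * |s - t| ^ τ)
    (heq : ∀ i ∈ Set.Icc 1 N, ∀ t ∈ Set.Icc (0 : ℝ) 1,
      f ((x i - x (i - 1)) * t + x (i - 1)) = a i * f t + g i t) :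
    ∃ C > 0, ∀ s ∈ Set.Icc (0 : ℝ) 1, ∀ t ∈ Set.Icc (0 : ℝ) 1,
      |f s - f t| ≤ C * |s - t| ^ τ := by
  refine holder_of_selfAffine hN hx0 hxN hx hτ hfc hg heq fun K hK => ?_
  have hA := fun i (hi : i ∈ Set.Icc 1 N) =>
    le_maxOver (fun i => M / ((x i - x (i - 1)) ^ τ - |a i|)) hi
  set A := max K (maxOver N (fun i => M / ((x i - x (i - 1)) ^ τ - |a i|)))
  have hA0 : 0 < A := hK.trans_le (le_max_left _ _)
  refine ⟨fun h => A * h ^ τ, A, hA0, fun h h0 h1 => ⟨?_, le_rfl⟩, fun i hi h h0 h1 => ?_⟩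
  · exact mul_le_mul_of_nonneg_right (le_max_left _ _) (Real.rpow_nonneg h0.le τ)
  · have h3 := (div_le_iff₀ (sub_pos.2 (ha i hi))).1 ((hA i hi).trans (le_max_right K _))
    have h4 := mul_le_mul_of_nonneg_right h3 (Real.rpow_nonneg h0.le τ)
    simp only [Real.mul_rpow (partition_length_pos hx hi).le h0.le]
    linarith

theorem rpow_abs_sub_le {s t u v : ℝ} (hs : s ∈ Set.Icc (0 : ℝ) 1) (ht : t ∈ Set.Icc (0 : ℝ) 1)
    (hu : 0 ≤ u) (huv : u ≤ v) : |s - t| ^ v ≤ |s - t| ^ u := by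
  refine Real.rpow_le_rpow_of_exponent_ge' (abs_nonneg _) ?_ hu huv
  rw [abs_le]
  constructor <;> linarith [hs.1, hs.2, ht.1, ht.2]

/-- Finitely many Hölder functions share a constant and the smallest of their exponents. -/
theorem exists_uniform_holder {N : ℕ} (hN : 1 ≤ N) {e : ℕ → ℝ} {g : ℕ → ℝ → ℝ}
    (he : ∀ i ∈ Set.Icc 1 N, e i ∈ Set.Ioc (0 : ℝ) 1)
    (hg : ∀ i ∈ Set.Icc 1 N, ∃ M > 0, ∀ s ∈ Set.Icc (0 : ℝ) 1, ∀ t ∈ Set.Icc (0 : ℝ) 1,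
      |g i s - g i t| ≤ M * |s - t| ^ e i) :
    0 < minOver N e ∧ ∃ M > 0, ∀ i ∈ Set.Icc 1 N, ∀ s ∈ Set.Icc (0 : ℝ) 1,
      ∀ t ∈ Set.Icc (0 : ℝ) 1, |g i s - g i t| ≤ M * |s - t| ^ minOver N e := by
  obtain ⟨j, hj, hje⟩ := exists_eq_minOver hN e
  have hpos : 0 < minOver N e := hje ▸ (he j hj).1
  choose! M hM0 hM using hg
  refine ⟨hpos, maxOver N M, (hM0 j hj).trans_le (le_maxOver M hj), fun i hi s hs t ht => ?_⟩
  refine (hM i hi s hs t ht).trans ?_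
  exact mul_le_mul (le_maxOver M hi) (rpow_abs_sub_le hs ht hpos.le (minOver_le e hi))
    (by positivity) ((hM0 i hi).le.trans (le_maxOver M hi))

/-- If `Θ < 1`, `Ω < 1` and `Γ > 1`, then `f₁ ∈ Lip δ` with `δ = min (λ, log γ / log |I_min|)`. -/
theorem chfif_theta_lt_one_omega_lt_one_gamma_gt_one
    (N : ℕ) (hN : 2 ≤ N)
    (x : ℕ → ℝ) (hx0 : x 0 = 0) (hxN : x N = 1)
    (hxmono : ∀ i < N, x i < x (i + 1))
    (α β γ : ℕ → ℝ)
    (hα : ∀ i ∈ Set.Icc 1 N, |α i| < 1)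
    (hβγ : ∀ i ∈ Set.Icc 1 N, |β i| + |γ i| < 1)
    (lam mu : ℕ → ℝ)
    (hlam : ∀ i ∈ Set.Icc 1 N, lam i ∈ Set.Ioc (0 : ℝ) 1)
    (hmu : ∀ i ∈ Set.Icc 1 N, mu i ∈ Set.Ioc (0 : ℝ) 1)
    (p q : ℕ → ℝ → ℝ)
    (hp : ∀ i ∈ Set.Icc 1 N, ∃ M > 0, ∀ s ∈ Set.Icc (0 : ℝ) 1, ∀ t ∈ Set.Icc (0 : ℝ) 1,
      |p i s - p i t| ≤ M * |s - t| ^ lam i)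
    (hq : ∀ i ∈ Set.Icc 1 N, ∃ M > 0, ∀ s ∈ Set.Icc (0 : ℝ) 1, ∀ t ∈ Set.Icc (0 : ℝ) 1,
      |q i s - q i t| ≤ M * |s - t| ^ mu i)
    (f₁ f₂ : ℝ → ℝ)
    (hf₁c : ContinuousOn f₁ (Set.Icc 0 1)) (hf₂c : ContinuousOn f₂ (Set.Icc 0 1))
    (heq₁ : ∀ i ∈ Set.Icc 1 N, ∀ t ∈ Set.Icc (0 : ℝ) 1,
      f₁ ((x i - x (i - 1)) * t + x (i - 1)) = α i * f₁ t + β i * f₂ t + p i t)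
    (heq₂ : ∀ i ∈ Set.Icc 1 N, ∀ t ∈ Set.Icc (0 : ℝ) 1,
      f₂ ((x i - x (i - 1)) * t + x (i - 1)) = γ i * f₂ t + q i t)
    (hΘ : maxOver N (fun i => |α i| / (x i - x (i - 1)) ^ minOver N mu) < 1)
    (hΩ : maxOver N (fun i => |α i| / (x i - x (i - 1)) ^ minOver N lam) < 1)
    (hΓ : 1 < maxOver N (fun i => |γ i| / (x i - x (i - 1)) ^ minOver N mu))
    :
    ∃ C > 0, ∀ s ∈ Set.Icc (0 : ℝ) 1, ∀ t ∈ Set.Icc (0 : ℝ) 1,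
      |f₁ s - f₁ t| ≤ C * |s - t| ^ (min (minOver N lam) (Real.log (maxOver N (fun i => |γ i|)) / Real.log (minOver N (fun i => x i - x (i - 1))))) := by
  have hN1 : 1 ≤ N := by omega
  obtain ⟨hlam0, Mp, hMp, hp'⟩ := exists_uniform_holder hN1 hlam hp
  obtain ⟨hmu0, Mq, hMq, hq'⟩ := exists_uniform_holder hN1 hmu hq
  have hl : ∀ i ∈ Set.Icc 1 N, 0 < x i - x (i - 1) :=
    fun i hi => partition_length_pos hxmono hi
  obtain ⟨ic, hic, hc⟩ := exists_eq_minOver hN1 (fun i => x i - x (i - 1))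
  have hcle := fun i (hi : i ∈ Set.Icc 1 N) => minOver_le (fun i => x i - x (i - 1)) hi
  have hc0 := hl ic hic
  have hc1 := partition_length_lt_one hN hx0 hxN hxmono hic
  rw [hc] at hc0 hc1
  set c := minOver N (fun i => x i - x (i - 1))
  obtain ⟨ig, hig, hg⟩ := exists_eq_maxOver hN1 (fun i => |γ i|)
  have hγle := fun i (hi : i ∈ Set.Icc 1 N) => le_maxOver (fun i => |γ i|) hi
  have hg1 : |γ ig| < 1 := by linarith [hβγ ig hig, abs_nonneg (β ig)]
  rw [hg] at hg1
  set G := maxOver N (fun i => |γ i|)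
  obtain ⟨k, hk, hkΓ⟩ := exists_eq_maxOver hN1 (fun i => |γ i| / (x i - x (i - 1)) ^ minOver N mu)
  have hcG : c ^ minOver N mu < G := by
    rw [← hkΓ] at hΓ
    calc c ^ minOver N mu ≤ (x k - x (k - 1)) ^ minOver N mu :=
          Real.rpow_le_rpow hc0.le (hcle k hk) hmu0.le
      _ < |γ k| := (one_lt_div (Real.rpow_pos_of_pos (hl k hk) _)).1 hΓ
      _ ≤ G := hγle k hk
  have hG0 : 0 < G := (Real.rpow_pos_of_pos hc0 _).trans hcG
  have hlogc : Real.log c < 0 := Real.log_neg hc0 hc1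
  set τ := Real.log G / Real.log c with hτdef
  have hτ0 : 0 < τ := div_pos_of_neg_of_neg (Real.log_neg hG0 hg1) hlogc
  have hτmu : τ < minOver N mu := by
    rw [hτdef, div_lt_iff_of_neg hlogc, ← Real.log_rpow hc0]
    exact Real.log_lt_log (Real.rpow_pos_of_pos hc0 _) hcG
  have hcτ : c ^ τ = G := by
    rw [Real.rpow_def_of_pos hc0, hτdef, mul_div_cancel₀ _ hlogc.ne, Real.exp_log hG0]
  obtain ⟨C₂, hC₂, hf₂⟩ := holder_of_selfAffine_of_lt hN hx0 hxN hxmono hMq.le hτ0 hτmu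
    (fun i hi => (hγle i hi).trans (hcτ ▸ Real.rpow_le_rpow hc0.le (hcle i hi) hτ0.le))
    hf₂c hq' heq₂
  have hδ0 : 0 < min (minOver N lam) τ := lt_min hlam0 hτ0
  refine holder_of_selfAffine_of_scaling_lt hN hx0 hxN hxmono (a := α)
    (g := fun i t => β i * f₂ t + p i t) (M := C₂ + Mp) hδ0 ?_ hf₁c ?_ ?_
  · intro i hi
    have h1 := (le_maxOver (fun i => |α i| / (x i - x (i - 1)) ^ minOver N lam) hi).trans_lt hΩ
    exact ((div_lt_one (Real.rpow_pos_of_pos (hl i hi) _)).1 h1).trans_le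
      (Real.rpow_le_rpow_of_exponent_ge (hl i hi)
        (partition_length_lt_one hN hx0 hxN hxmono hi).le (min_le_left _ _))
  · intro i hi s hs t ht
    have hβ : |β i| ≤ 1 := by linarith [hβγ i hi, abs_nonneg (γ i)]
    calc |β i * f₂ s + p i s - (β i * f₂ t + p i t)|
        = |β i * (f₂ s - f₂ t) + (p i s - p i t)| := by congr 1; ring
      _ ≤ |β i| * |f₂ s - f₂ t| + |p i s - p i t| := by
          rw [← abs_mul]; exact abs_add_le _ _
      _ ≤ 1 * (C₂ * |s - t| ^ τ) + Mp * |s - t| ^ minOver N lam := by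
          gcongr
          · exact hf₂ s hs t ht
          · exact hp' i hi s hs t ht
      _ ≤ 1 * (C₂ * |s - t| ^ min (minOver N lam) τ)
            + Mp * |s - t| ^ min (minOver N lam) τ := by
          gcongr 1
          · gcongr 2
            exact rpow_abs_sub_le hs ht hδ0.le (min_le_right _ _)
          · gcongr 1
            exact rpow_abs_sub_le hs ht hδ0.le (min_le_left _ _)
      _ = _ := by ring
  · intro i hi t ht
    rw [heq₁ i hi t ht]
    ring
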